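/- arXiv:1206.7017 — 4 statements merged into one kernel-verified Lean document; each statement's English description precedes it below -/
import Mathlib

section
/- Let A be an associative unital algebra over a field of characteristic zero. For elements z_1, …, z_n of A define the antisymmetrized product γ(z_1, …, z_n) = (1/n!) · Σ_{σ ∈ S_n} sgn(σ) · z_{σ(1)} ⋯ z_{σ(n)}. If x_1, …, x_r and y_1, …, y_s are elements of A such that x_i · y_j = − y_j · x_i for all i = 1, …, r and j = 1, …, s, then γ(x_1, …, x_r, y_1, …, y_s) = γ(x_1, …, x_r) · γ(y_1, …, y_s). -/
/-- The antisymmetrized product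
`γ(z₁, …, zₙ) = (1/n!) · Σ_{σ ∈ Sₙ} sgn(σ) · z_{σ(1)} ⋯ z_{σ(n)}`
of a family of elements of an algebra `A` over a field `K`. -/
noncomputable def antisymProd (K : Type*) {A : Type*} [Field K] [Ring A] [Algebra K A]
    {n : ℕ} (z : Fin n → A) : A :=
  ((n.factorial : K)⁻¹) •
    ∑ σ : Equiv.Perm (Fin n),
      ((Equiv.Perm.sign σ : ℤ) • (List.ofFn (fun i => z (σ i))).prod)

/-- Exchanging two anticommuting neighbours negates an ordered product. -/
theorem List.prod_ofFn_swap_castSucc_succ {A : Type*} [Ring A] {n : ℕ} (w : Fin (n + 1) → A)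
    (i : Fin n) (h : w i.castSucc * w i.succ = -(w i.succ * w i.castSucc)) :
    (List.ofFn fun k => w (Equiv.swap i.castSucc i.succ k)).prod = -(List.ofFn w).prod := by
  induction n with
  | zero => exact i.elim0
  | succ n ih =>
    rw [List.ofFn_succ, List.ofFn_succ (f := w), List.prod_cons, List.prod_cons]
    induction i using Fin.cases with
    | zero =>
      have hs (k : Fin n) : Equiv.swap (0 : Fin (n + 2)) 1 k.succ.succ = k.succ.succ :=
        Equiv.swap_apply_of_ne_of_ne (Fin.succ_ne_zero _) (by simp [Fin.ext_iff])
      simp only [Fin.castSucc_zero, Fin.succ_zero_eq_one] at h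
      simp [List.ofFn_succ, hs, ← mul_assoc, h]
    | succ j =>
      have hs (k : Fin (n + 1)) : Equiv.swap j.succ.castSucc j.succ.succ k.succ =
          (Equiv.swap j.castSucc j.succ k).succ := by
        rw [Fin.castSucc_succ, (Fin.succ_injective _).swap_apply]
      have h0 : Equiv.swap j.succ.castSucc j.succ.succ 0 = 0 :=
        Equiv.swap_apply_of_ne_of_ne (by simp [Fin.ext_iff]) (by simp [Fin.ext_iff])
      have := ih (fun k => w k.succ) j h
      simp only [hs, h0, this, mul_neg]

/-- A function on permutations of `Fin n` that is invariant under right multiplication by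
adjacent transpositions is constant. -/
theorem Equiv.Perm.eq_apply_one_of_mul_swap_castSucc_succ {α : Type*} {n : ℕ}
    (f : Equiv.Perm (Fin (n + 1)) → α)
    (h : ∀ σ (i : Fin n), f (σ * Equiv.swap i.castSucc i.succ) = f σ)
    (σ : Equiv.Perm (Fin (n + 1))) : f σ = f 1 := by
  have hσ : σ ∈ Submonoid.closure (Set.range fun i : Fin n => Equiv.swap i.castSucc i.succ) := by
    rw [Equiv.Perm.mclosure_swap_castSucc_succ]
    trivial
  induction hσ using Submonoid.closure_induction_right with
  | one => rfl
  | mul_right τ _ t ht ih =>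
    obtain ⟨i, rfl⟩ := ht
    rw [h, ih]

/-- The signed ordered product of a family along a permutation. -/
def signedProd {A : Type*} [Ring A] {n : ℕ} (z : Fin n → A) (σ : Equiv.Perm (Fin n)) : A :=
  (Equiv.Perm.sign σ : ℤ) • (List.ofFn fun i => z (σ i)).prod

theorem signedProd_mul_swap {A : Type*} [Ring A] {n : ℕ} (z : Fin (n + 1) → A)
    (σ : Equiv.Perm (Fin (n + 1))) (i : Fin n)
    (h : z (σ i.castSucc) * z (σ i.succ) = -(z (σ i.succ) * z (σ i.castSucc))) :
    signedProd z (σ * Equiv.swap i.castSucc i.succ) = signedProd z σ := by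
  have := List.prod_ofFn_swap_castSucc_succ (fun k => z (σ k)) i h
  simp only [signedProd, Equiv.Perm.mul_apply, this, Equiv.Perm.sign_mul,
    Equiv.Perm.sign_swap i.castSucc_lt_succ.ne, mul_neg, mul_one, Units.val_neg, neg_smul_neg]

/-- The block permutation of `Fin n` given by permutations of the summands of
`Fin r ⊕ Fin s ≃ Fin n`. -/
def blockPerm {r s n : ℕ} (e : Fin r ⊕ Fin s ≃ Fin n) :
    Equiv.Perm (Fin r) × Equiv.Perm (Fin s) →* Equiv.Perm (Fin n) :=
  (e.permCongrHom : _ →* _).comp (Equiv.Perm.sumCongrHom (Fin r) (Fin s))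

theorem sum_signedProd_blockPerm_mul {A : Type*} [Ring A] {r s n : ℕ}
    (e : Fin r ⊕ Fin s ≃ Fin n) (z : Fin n → A)
    (h : ∀ i j, z (e (.inl i)) * z (e (.inr j)) = -(z (e (.inr j)) * z (e (.inl i))))
    (σ : Equiv.Perm (Fin n)) :
    ∑ g, signedProd z (blockPerm e g * σ) = ∑ g, signedProd z (blockPerm e g) := by
  cases n with
  | zero => simp [Subsingleton.elim σ 1]
  | succ n =>
    have key := Equiv.Perm.eq_apply_one_of_mul_swap_castSucc_succ
      (fun σ => ∑ g, signedProd z (blockPerm e g * σ)) ?_ σ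
    · simpa using key
    intro σ i
    have block (g₀) (hg : σ * Equiv.swap i.castSucc i.succ = blockPerm e g₀ * σ) :
        ∑ g, signedProd z (blockPerm e g * (σ * Equiv.swap i.castSucc i.succ)) =
          ∑ g, signedProd z (blockPerm e g * σ) := by
      rw [hg]
      exact Fintype.sum_equiv (Equiv.mulRight g₀) _ _ fun g => by simp [mul_assoc]
    obtain ⟨a, ha⟩ := e.surjective (σ i.castSucc)
    obtain ⟨b, hb⟩ := e.surjective (σ i.succ)
    rcases a with a | a <;> rcases b with b | b
    · refine block (Equiv.swap a b, 1) ?_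
      rw [Equiv.mul_swap_eq_swap_mul, ← ha, ← hb]
      simp [blockPerm, Equiv.permCongrHom, Equiv.permCongr_def, Equiv.symm_trans_swap_trans]
    · refine Finset.sum_congr rfl fun g _ => ?_
      rw [← mul_assoc]
      apply signedProd_mul_swap
      simp [blockPerm, ← ha, ← hb, h]
    · refine Finset.sum_congr rfl fun g _ => ?_
      rw [← mul_assoc]
      apply signedProd_mul_swap
      simp [blockPerm, ← ha, ← hb, h]
    · refine block (1, Equiv.swap a b) ?_
      rw [Equiv.mul_swap_eq_swap_mul, ← ha, ← hb]
      simp [blockPerm, Equiv.permCongrHom, Equiv.permCongr_def, Equiv.symm_trans_swap_trans]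

theorem signedProd_append_blockPerm {A : Type*} [Ring A] {r s : ℕ} (x : Fin r → A) (y : Fin s → A)
    (a : Equiv.Perm (Fin r)) (b : Equiv.Perm (Fin s)) :
    signedProd (Fin.append x y) (blockPerm finSumFinEquiv (a, b)) =
      signedProd x a * signedProd y b := by
  have hs : Equiv.Perm.sign (blockPerm finSumFinEquiv (a, b)) =
      Equiv.Perm.sign a * Equiv.Perm.sign b := by
    simp [blockPerm]
  have hl : (fun i => Fin.append x y (blockPerm finSumFinEquiv (a, b) i)) =
      Fin.append (fun i => x (a i)) (fun j => y (b j)) := by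
    ext i
    induction i using Fin.addCases <;> simp [blockPerm]
  rw [signedProd, hs, hl, List.ofFn_fin_append, List.prod_append, signedProd, signedProd,
    smul_mul_smul_comm, Units.val_mul]

/-- Multiplicativity of antisymmetrized products up to factorials, valid in any ring. -/
theorem factorial_mul_factorial_smul_sum_signedProd_append {A : Type*} [Ring A] {r s : ℕ}
    (x : Fin r → A) (y : Fin s → A) (h : ∀ i j, x i * y j = -(y j * x i)) :
    (r.factorial * s.factorial) • ∑ σ, signedProd (Fin.append x y) σ =
      (r + s).factorial • ((∑ a, signedProd x a) * ∑ b, signedProd y b) := by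
  calc
    _ = ∑ g, ∑ σ, signedProd (Fin.append x y) (blockPerm finSumFinEquiv g * σ) := by
      have hg (g) : ∑ σ, signedProd (Fin.append x y) (blockPerm finSumFinEquiv g * σ) =
          ∑ σ, signedProd (Fin.append x y) σ :=
        Fintype.sum_equiv (Equiv.mulLeft (blockPerm finSumFinEquiv g)) _ _ fun _ => rfl
      simp [hg, Fintype.card_perm]
    _ = ∑ σ : Equiv.Perm (Fin (r + s)), ∑ g,
          signedProd (Fin.append x y) (blockPerm finSumFinEquiv g) := by
      rw [Finset.sum_comm]
      exact Finset.sum_congr rfl fun σ _ =>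
        sum_signedProd_blockPerm_mul _ _ (by simpa using h) σ
    _ = _ := by
      simp [Fintype.sum_prod_type, signedProd_append_blockPerm, Finset.sum_mul_sum,
        Fintype.card_perm]

theorem antisymProd_append_of_anticommute
    (K : Type*) {A : Type*} [Field K] [CharZero K] [Ring A] [Algebra K A]
    {r s : ℕ} (x : Fin r → A) (y : Fin s → A)
    (h : ∀ i j, x i * y j = -(y j * x i)) :
    antisymProd K (Fin.append x y) = antisymProd K x * antisymProd K y := by
  have key := factorial_mul_factorial_smul_sum_signedProd_append x y h
  have hr : (r.factorial : K) ≠ 0 := Nat.cast_ne_zero.mpr r.factorial_ne_zero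
  have hs : (s.factorial : K) ≠ 0 := Nat.cast_ne_zero.mpr s.factorial_ne_zero
  have hn : ((r + s).factorial : K) ≠ 0 := Nat.cast_ne_zero.mpr (r + s).factorial_ne_zero
  rw [← Nat.cast_smul_eq_nsmul K, ← Nat.cast_smul_eq_nsmul K, Nat.cast_mul] at key
  change (_ : K)⁻¹ • ∑ σ, signedProd _ σ =
    ((_ : K)⁻¹ • ∑ σ, signedProd x σ) * ((_ : K)⁻¹ • ∑ σ, signedProd y σ)
  rw [smul_mul_smul_comm, inv_smul_eq_iff₀ hn, smul_comm, ← key, ← mul_inv,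
    inv_smul_smul₀ (mul_ne_zero hr hs)]
end

section
/- Let A be an associative unital algebra over ℂ and let m ⊆ A be a two-sided ideal with m^{n+1} = 0 for some natural number n (with the convention m^0 = A). Then there exists a derivation D : A → A adapted to the filtration A ⊇ m ⊇ m² ⊇ … (i.e., satisfying (D − r·id)(m^r) ⊆ m^{r+1} for every r ≥ 0) if and only if the filtration is splittable, i.e., there exist ℂ-submodules A_p of A for p ∈ ℕ with 1 ∈ A_0, A_p · A_q ⊆ A_{p+q} for all p, q, A = ⊕_{p ≥ 0} A_p as a ℂ-module (internal direct sum), and m^r = ⊕_{p ≥ r} A_p for every r ≥ 0. -/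
/-- Powers of an ideal `m` of an algebra `A`, with the convention `m^0 = A` (not the
unit submodule). -/
def mpow {A : Type*} [Ring A] [Algebra ℂ A] (m : Submodule ℂ A) : ℕ → Submodule ℂ A
  | 0 => ⊤
  | r + 1 => m ^ (r + 1)

theorem mpow_succ_le {A : Type*} [Ring A] [Algebra ℂ A] (m : Submodule ℂ A)
    (hm : m * m ≤ m) (r : ℕ) : mpow m (r + 1) ≤ mpow m r := by
  cases r with
  | zero => exact le_top
  | succ k =>
    change m ^ (k + 1 + 1) ≤ m ^ (k + 1)
    rw [pow_succ, pow_succ, mul_assoc]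
    exact mul_le_mul_right hm _

/-- An element of a supremum of submodules indexed by `p ≥ r` satisfies any additive property
that holds on each of them. -/
theorem iSup_ge_induction {R M : Type*} [Semiring R] [AddCommMonoid M] [Module R M]
    {V : ℕ → Submodule R M} {r : ℕ} {C : M → Prop} (hV : ∀ p ≥ r, ∀ x ∈ V p, C x)
    (h0 : C 0) (hadd : ∀ x y, C x → C y → C (x + y)) {x : M} (hx : x ∈ ⨆ p ≥ r, V p) : C x := by
  rw [iSup_subtype'] at hx
  exact Submodule.iSup_induction _ (motive := C) hx (fun p y hy => hV p p.2 y hy) h0 hadd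

theorem mem_mpow_of_eigenvector {A : Type*} [Ring A] [Algebra ℂ A] {m : Submodule ℂ A}
    {D : A →ₗ[ℂ] A} (hD : ∀ r : ℕ, ∀ x ∈ mpow m r, D x - (r : ℂ) • x ∈ mpow m (r + 1))
    {p : ℕ} {x : A} (hx : D x = (p : ℂ) • x) {r : ℕ} (hr : r ≤ p) : x ∈ mpow m r := by
  induction r with
  | zero => exact Submodule.mem_top
  | succ k ih =>
    have h := hD k x (ih (by omega))
    rw [hx, ← sub_smul] at h
    refine (Submodule.smul_mem_iff _ (sub_ne_zero.2 ?_)).1 h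
    exact_mod_cast (show p ≠ k by omega)

/-- On the sum of the eigenspaces for the eigenvalues `p > r`, the operator `D - r` is
surjective. -/
theorem exists_sub_smul_eq_of_mem_iSup_eigenspace {M : Type*} [AddCommGroup M] [Module ℂ M]
    (D : Module.End ℂ M) (r : ℕ) {z : M}
    (hz : z ∈ ⨆ p ≥ r + 1, D.eigenspace ((p : ℕ) : ℂ)) :
    ∃ y ∈ ⨆ p ≥ r + 1, D.eigenspace ((p : ℕ) : ℂ), D y - (r : ℂ) • y = z := by
  refine iSup_ge_induction (C := fun z => ∃ y ∈ ⨆ p ≥ r + 1, D.eigenspace ((p : ℕ) : ℂ),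
    D y - (r : ℂ) • y = z) ?_ ⟨0, zero_mem _, by simp⟩ ?_ hz
  · intro p hp x hx
    have hne : (p : ℂ) - r ≠ 0 := sub_ne_zero.2 (by exact_mod_cast (show p ≠ r by omega))
    refine ⟨((p : ℂ) - r)⁻¹ • x, Submodule.smul_mem _ _ ?_, ?_⟩
    · exact Submodule.mem_iSup_of_mem p (Submodule.mem_iSup_of_mem hp hx)
    · rw [map_smul, Module.End.mem_eigenspace_iff.1 hx, smul_comm (r : ℂ), ← smul_sub, ← sub_smul,
        inv_smul_smul₀ hne]
  · rintro _ _ ⟨y, hy, rfl⟩ ⟨y', hy', rfl⟩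
    exact ⟨y + y', add_mem hy hy', by rw [map_add, smul_add]; abel⟩

theorem mpow_eq_iSup_eigenspace {A : Type*} [Ring A] [Algebra ℂ A] {m : Submodule ℂ A}
    (hm : m * m ≤ m) {n : ℕ} (hnil : mpow m (n + 1) = ⊥) {D : Module.End ℂ A}
    (hD : ∀ r : ℕ, ∀ x ∈ mpow m r, D x - (r : ℂ) • x ∈ mpow m (r + 1)) (r : ℕ) :
    mpow m r = ⨆ p ≥ r, D.eigenspace ((p : ℕ) : ℂ) := by
  have hanti : Antitone (mpow m) := antitone_nat_of_succ_le (mpow_succ_le m hm)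
  refine le_antisymm ?_ (iSup₂_le fun p hp x hx =>
    mem_mpow_of_eigenvector hD (Module.End.mem_eigenspace_iff.1 hx) hp)
  rcases le_total (n + 1) r with h | h
  · exact (hanti h).trans (hnil.le.trans bot_le)
  · induction h using Nat.decreasingInduction with
    | self => exact hnil.le.trans bot_le
    | of_succ k _ ih =>
      intro x hx
      have hle : ⨆ p ≥ k + 1, D.eigenspace ((p : ℕ) : ℂ) ≤ ⨆ p ≥ k, D.eigenspace ((p : ℕ) : ℂ) :=
        biSup_mono fun p hp => (Nat.le_succ k).trans hp
      obtain ⟨y, hy, hyx⟩ := exists_sub_smul_eq_of_mem_iSup_eigenspace D k (ih (hD k x hx))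
      have hxy : x - y ∈ D.eigenspace ((k : ℕ) : ℂ) := by
        rw [Module.End.mem_eigenspace_iff, map_sub, smul_sub, sub_eq_sub_iff_sub_eq_sub, ← hyx]
      rw [← sub_add_cancel x y]
      exact add_mem (Submodule.mem_iSup_of_mem k (Submodule.mem_iSup_of_mem le_rfl hxy)) (hle hy)

/-- An internal direct sum decomposition indexed by `ℕ` has a degree operator. -/
theorem DirectSum.IsInternal.exists_degree_operator {M : Type*} [AddCommGroup M] [Module ℂ M]
    {V : ℕ → Submodule ℂ M} (hV : DirectSum.IsInternal V) :
    ∃ D : M →ₗ[ℂ] M, ∀ p : ℕ, ∀ x ∈ V p, D x = (p : ℂ) • x := by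
  let e := LinearEquiv.ofBijective (DirectSum.coeLinearMap V) hV
  refine ⟨DirectSum.toModule ℂ ℕ M (fun p => (p : ℂ) • (V p).subtype) ∘ₗ e.symm.toLinearMap,
    fun p x hx => ?_⟩
  have he : e.symm x = DirectSum.lof ℂ ℕ (fun i => V i) p ⟨x, hx⟩ := by
    rw [LinearEquiv.symm_apply_eq]
    exact (DirectSum.coeLinearMap_lof V p ⟨x, hx⟩).symm
  simp [he]

/-- Koszul's splitting criterion: for a ℂ-algebra `A` with a two-sided ideal `m`
satisfying `m^(n+1) = 0`, there is a derivation `D` adapted to the filtration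
`A ⊇ m ⊇ m² ⊇ …` (i.e. `(D - r·id)(m^r) ⊆ m^(r+1)` for all `r ≥ 0`) if and only if the
filtration is splittable, i.e. comes from an ℕ-grading `A = ⊕_{p≥0} A_p` with
`m^r = ⊕_{p ≥ r} A_p` for every `r`. -/
theorem adapted_derivation_exists_iff_splittable
    {A : Type*} [Ring A] [Algebra ℂ A] (m : Submodule ℂ A)
    (hleft : ∀ a : A, ∀ x ∈ m, a * x ∈ m) (hright : ∀ a : A, ∀ x ∈ m, x * a ∈ m)
    (n : ℕ) (hnil : mpow m (n + 1) = ⊥) :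
    (∃ D : A →ₗ[ℂ] A,
        (∀ a b : A, D (a * b) = D a * b + a * D b) ∧
        (∀ r : ℕ, ∀ x ∈ mpow m r, D x - (r : ℂ) • x ∈ mpow m (r + 1))) ↔
    (∃ Ap : ℕ → Submodule ℂ A,
        (1 : A) ∈ Ap 0 ∧
        (∀ p q : ℕ, ∀ a ∈ Ap p, ∀ b ∈ Ap q, a * b ∈ Ap (p + q)) ∧
        DirectSum.IsInternal Ap ∧
        (∀ r : ℕ, mpow m r = ⨆ p ≥ r, Ap p)) := by
  constructor
  · rintro ⟨D, hmul, hD⟩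
    have hm : m * m ≤ m := Submodule.mul_le.2 fun a _ x hx => hleft a x hx
    have hpow := mpow_eq_iSup_eigenspace (D := D) hm hnil hD
    refine ⟨fun p => Module.End.eigenspace D (p : ℂ), ?_, ?_, ?_, hpow⟩
    · have h := hmul 1 1
      simp only [mul_one, one_mul, left_eq_add] at h
      simp [h]
    · intro p q a ha b hb
      rw [Module.End.mem_eigenspace_iff] at ha hb ⊢
      rw [hmul, ha, hb, smul_mul_assoc, mul_smul_comm, ← add_smul, Nat.cast_add]
    · refine DirectSum.isInternal_submodule_of_iSupIndep_of_iSup_eq_top ?_ ?_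
      · exact (Module.End.eigenspaces_iSupIndep D).comp Nat.cast_injective
      · have h := hpow 0
        simp only [ge_iff_le, zero_le, iSup_pos] at h
        exact h.symm
  · rintro ⟨Ap, -, hmul, hint, hpow⟩
    obtain ⟨D, hD⟩ := hint.exists_degree_operator
    have htop : ∀ x : A, x ∈ iSup Ap := fun x => by
      rw [hint.submodule_iSup_eq_top]
      exact Submodule.mem_top
    refine ⟨D, fun a b => ?_, fun r x hx => ?_⟩
    · refine Submodule.iSup_induction Ap (motive := fun a => D (a * b) = D a * b + a * D b)
        (htop a) (fun p a ha => ?_) (by simp) ?_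
      · refine Submodule.iSup_induction Ap (motive := fun b => D (a * b) = D a * b + a * D b)
          (htop b) (fun q b hb => ?_) (by simp) ?_
        · rw [hD _ _ (hmul p q a ha b hb), hD p a ha, hD q b hb, smul_mul_assoc, mul_smul_comm,
            ← add_smul, Nat.cast_add]
        · intro x y hx hy
          simp only [mul_add, map_add, hx, hy]
          abel
      · intro x y hx hy
        simp only [add_mul, map_add, hx, hy]
        abel
    · rw [hpow] at hx ⊢
      refine iSup_ge_induction (C := fun x => D x - (r : ℂ) • x ∈ ⨆ p ≥ r + 1, Ap p)
        (fun p hp x hx => ?_) (by simp) ?_ hx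
      · rw [hD p x hx, ← sub_smul]
        rcases hp.lt_or_eq with h | rfl
        · exact Submodule.smul_mem _ _
            (Submodule.mem_iSup_of_mem p (Submodule.mem_iSup_of_mem h hx))
        · simp
      · intro x y hx hy
        rw [map_add, smul_add, add_sub_add_comm]
        exact add_mem hx hy
end

section
/- Let A be an associative unital algebra over ℂ, let m ⊆ A be a two-sided ideal with m^{n+1} = 0 for some natural number n (with m^0 = A), and let D : A → A be a derivation adapted to the filtration, i.e., (D − r·id)(m^r) ⊆ m^{r+1} for every r ≥ 0. For p ∈ ℕ set A_p = ker(D − p·id). Then: (i) A is the internal direct sum ⊕_{p=0}^{n} A_p as a ℂ-module; (ii) 1 ∈ A_0 and A_p · A_q ⊆ A_{p+q} for all p, q (so the A_p form an algebra grading of A); and (iii) m^r = ⊕_{p ≥ r} A_p for every r ≥ 0. -/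
namespace Module.End

variable {K V : Type*} [Field K] [CharZero K] [AddCommGroup V] [Module K V]
  {D : End K V} {F : ℕ → Submodule K V}

/-- Let `D` act as `r` on the `r`-th graded piece of a filtration `F` with `F 0 = ⊤`. Then the
eigenspace of `D` for the eigenvalue `p` is contained in `F r` for every `r ≤ p`. -/
theorem eigenspace_natCast_le_filtration (htop : F 0 = ⊤)
    (hD : ∀ r : ℕ, ∀ x ∈ F r, D x - (r : K) • x ∈ F (r + 1)) {r p : ℕ} (hrp : r ≤ p) :
    D.eigenspace (p : K) ≤ F r := by
  intro x hx
  rw [mem_eigenspace_iff] at hx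
  induction r with
  | zero => simp [htop]
  | succ s ih =>
    have hmem := hD s x (ih (by lia))
    rw [hx, ← sub_smul] at hmem
    refine ((F (s + 1)).smul_mem_iff (sub_ne_zero.mpr ?_)).mp hmem
    exact_mod_cast (by lia : p ≠ s)

/-- `D - r` maps the sum of the eigenspaces of `D` with natural eigenvalues `p > r` onto itself. -/
theorem exists_sub_smul_eq_of_mem_iSup_eigenspace {r : ℕ} {y : V}
    (hy : y ∈ ⨆ p ≥ r + 1, D.eigenspace (p : K)) :
    ∃ z ∈ ⨆ p ≥ r + 1, D.eigenspace (p : K), D z - (r : K) • z = y := by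
  suffices h : ⨆ p ≥ r + 1, D.eigenspace (p : K) ≤
      (⨆ p ≥ r + 1, D.eigenspace (p : K)).map (D - (r : K) • 1) by
    obtain ⟨z, hz, hzy⟩ := h hy
    exact ⟨z, hz, by simpa using hzy⟩
  refine iSup₂_le fun p hp x hx => ?_
  have hpr : (p : K) - r ≠ 0 := sub_ne_zero.mpr (by exact_mod_cast (by lia : p ≠ r))
  refine ⟨((p : K) - r)⁻¹ • x, Submodule.smul_mem _ _
    (Submodule.mem_iSup_of_mem p (Submodule.mem_iSup_of_mem hp hx)), ?_⟩
  rw [map_smul, LinearMap.sub_apply, mem_eigenspace_iff.mp hx, LinearMap.smul_apply,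
    one_apply, ← sub_smul, inv_smul_smul₀ hpr]

/-- Eigenspaces of an endomorphism acting as `r` on the `r`-th graded piece of a finite filtration
split the filtration. -/
theorem filtration_eq_iSup_eigenspace {n : ℕ} (htop : F 0 = ⊤) (hbot : ∀ r > n, F r = ⊥)
    (hD : ∀ r : ℕ, ∀ x ∈ F r, D x - (r : K) • x ∈ F (r + 1)) (r : ℕ) :
    F r = ⨆ p ≥ r, D.eigenspace (p : K) := by
  refine le_antisymm ?_ (iSup₂_le fun p hp => eigenspace_natCast_le_filtration htop hD hp)
  induction hk : n + 1 - r generalizing r with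
  | zero => simp [hbot r (by lia)]
  | succ k ih =>
    intro x hx
    obtain ⟨z, hz, hzx⟩ := exists_sub_smul_eq_of_mem_iSup_eigenspace
      (ih (r + 1) (by lia) (hD r x hx))
    rw [← sub_add_cancel x z]
    refine add_mem (Submodule.mem_iSup_of_mem r (Submodule.mem_iSup_of_mem le_rfl ?_))
      (SetLike.le_def.mp (biSup_mono fun p (hp : p ≥ r + 1) => (by lia : p ≥ r)) hz)
    rw [mem_eigenspace_iff, map_sub, smul_sub, sub_eq_sub_iff_sub_eq_sub, ← hzx]

/-- An endomorphism acting as `r` on the `r`-th graded piece of a finite filtration is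
diagonalizable, with eigenvalues among `0, …, n`. -/
theorem isInternal_eigenspace_of_filtration {n : ℕ} (htop : F 0 = ⊤) (hbot : ∀ r > n, F r = ⊥)
    (hD : ∀ r : ℕ, ∀ x ∈ F r, D x - (r : K) • x ∈ F (r + 1)) :
    DirectSum.IsInternal fun p : Fin (n + 1) => D.eigenspace ((p : ℕ) : K) := by
  rw [DirectSum.isInternal_submodule_iff_iSupIndep_and_iSup_eq_top]
  refine ⟨D.eigenspaces_iSupIndep.comp (f := fun p : Fin (n + 1) => ((p : ℕ) : K))
    (Nat.cast_injective.comp Fin.val_injective), ?_⟩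
  rw [eq_top_iff, ← htop, filtration_eq_iSup_eigenspace htop hbot hD]
  refine iSup₂_le fun p _ => ?_
  rcases lt_or_ge n p with hp | hp
  · exact (eigenspace_natCast_le_filtration htop hD le_rfl).trans (by simp [hbot p hp])
  · exact le_iSup (fun p : Fin (n + 1) => D.eigenspace ((p : ℕ) : K)) ⟨p, by lia⟩

end Module.End

theorem mpow_eq_bot_of_lt {A : Type*} [Ring A] [Algebra ℂ A] {m : Submodule ℂ A} {n r : ℕ}
    (hnil : mpow m (n + 1) = ⊥) (hr : n < r) : mpow m r = ⊥ := by
  obtain ⟨k, rfl⟩ := Nat.exists_eq_add_of_lt hr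
  change m ^ (n + 1) = ⊥ at hnil
  change m ^ (n + k + 1) = ⊥
  rw [add_right_comm, pow_add, hnil, Submodule.bot_mul]

/-- The nontrivial direction of Koszul's splitting criterion, explicitly: if `D` is
a derivation of a ℂ-algebra `A` adapted to the filtration by powers of a two-sided
ideal `m` with `m^(n+1) = 0`, then the eigenspaces `A_p = ker(D - p·id)` form an
algebra grading of `A` (with `A = ⊕_{p=0}^{n} A_p`, `1 ∈ A_0`, `A_p·A_q ⊆ A_{p+q}`)
which splits the filtration: `m^r = ⊕_{p ≥ r} A_p` for every `r`. -/
theorem adapted_derivation_eigenspaces_grade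
    {A : Type*} [Ring A] [Algebra ℂ A] (m : Submodule ℂ A)
    (hleft : ∀ a : A, ∀ x ∈ m, a * x ∈ m) (hright : ∀ a : A, ∀ x ∈ m, x * a ∈ m)
    (n : ℕ) (hnil : mpow m (n + 1) = ⊥)
    (D : A →ₗ[ℂ] A)
    (hder : ∀ a b : A, D (a * b) = D a * b + a * D b)
    (hadapted : ∀ r : ℕ, ∀ x ∈ mpow m r, D x - (r : ℂ) • x ∈ mpow m (r + 1))
    (Ap : ℕ → Submodule ℂ A)
    (hAp : ∀ p : ℕ, Ap p = LinearMap.ker ((D : Module.End ℂ A) - (p : ℂ) • 1)) :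
    DirectSum.IsInternal (fun p : Fin (n + 1) => Ap p.val) ∧
    (1 : A) ∈ Ap 0 ∧
    (∀ p q : ℕ, ∀ a ∈ Ap p, ∀ b ∈ Ap q, a * b ∈ Ap (p + q)) ∧
    (∀ r : ℕ, mpow m r = ⨆ p ≥ r, Ap p) := by
  obtain rfl : Ap = fun p : ℕ => Module.End.eigenspace D (p : ℂ) := by
    ext p x
    rw [hAp, Module.End.mem_eigenspace_iff, LinearMap.mem_ker]
    simp [sub_eq_zero]
  have hbot : ∀ r > n, mpow m r = ⊥ := fun r hr => mpow_eq_bot_of_lt hnil hr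
  refine ⟨Module.End.isInternal_eigenspace_of_filtration rfl hbot hadapted, ?_, ?_,
    Module.End.filtration_eq_iSup_eigenspace rfl hbot hadapted⟩
  · simpa [Module.End.mem_eigenspace_iff] using hder 1 1
  · intro p q a ha b hb
    rw [Module.End.mem_eigenspace_iff] at ha hb ⊢
    rw [hder, ha, hb, smul_mul_assoc, mul_smul_comm, Nat.cast_add, add_smul]
end

section
/- Let A be an associative unital algebra over ℂ with a two-sided ideal m satisfying m^{n+1} = 0 for some natural number n (with m^0 = A). Suppose A = ⊕_{p ≥ 0} A_p and A = ⊕_{p ≥ 0} A'_p are two ℕ-gradings of A by ℂ-submodules (each with 1 in the degree-0 part and A_p·A_q ⊆ A_{p+q}, resp. A'_p·A'_q ⊆ A'_{p+q}) which both split the filtration by powers of m, i.e., m^r = ⊕_{p ≥ r} A_p = ⊕_{p ≥ r} A'_p for every r ≥ 0. Then there exists an algebra automorphism φ : A → A satisfying (φ − id)(m^r) ⊆ m^{r+1} for every r ≥ 0 such that φ(A_p) = A'_p for every p. Consequently, if W and W' are the grading derivations of the two gradings (acting as multiplication by p on A_p, resp. A'_p), then W' = φ ∘ W ∘ φ^{−1}.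 -/
open DirectSum in
/-- The projection onto the degree `p` part of a decomposition, as an endomorphism. -/
noncomputable def homogeneousProj {R M : Type*} [Ring R] [AddCommGroup M] [Module R M]
    (B : ℕ → Submodule R M) [Decomposition B] (p : ℕ) : M →ₗ[R] M :=
  (B p).subtype ∘ₗ component R ℕ (fun i => B i) p ∘ₗ (decomposeLinearEquiv B).toLinearMap

/-- The linear map which sends `a ∈ B p` to the degree `p` component of `a` with respect to `C`. -/
noncomputable def gradingComparison {R M : Type*} [Ring R] [AddCommGroup M] [Module R M]
    (B C : ℕ → Submodule R M) [DirectSum.Decomposition B] [DirectSum.Decomposition C] :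
    M →ₗ[R] M :=
  DirectSum.toModule R ℕ M (fun p => homogeneousProj C p ∘ₗ (B p).subtype) ∘ₗ
    (DirectSum.decomposeLinearEquiv B).toLinearMap

section Comparison

variable {R M : Type*} [Ring R] [AddCommGroup M] [Module R M]
  (B C : ℕ → Submodule R M) [DirectSum.Decomposition B] [DirectSum.Decomposition C]

theorem homogeneousProj_mem (p : ℕ) (x : M) : homogeneousProj B p x ∈ B p :=
  Subtype.property _

theorem homogeneousProj_of_mem {p : ℕ} {x : M} (hx : x ∈ B p) : homogeneousProj B p x = x :=
  DirectSum.decompose_of_mem_same B hx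

theorem homogeneousProj_of_mem_ne {p q : ℕ} {x : M} (hx : x ∈ B q) (hqp : q ≠ p) :
    homogeneousProj B p x = 0 :=
  DirectSum.decompose_of_mem_ne B hx hqp

theorem homogeneousProj_of_mem_iSup {p : ℕ} {x : M} (hx : x ∈ ⨆ q ≥ p + 1, B q) :
    homogeneousProj B p x = 0 := by
  have h : (⨆ q ≥ p + 1, B q) ≤ LinearMap.ker (homogeneousProj B p) :=
    iSup₂_le fun q hq y hy => homogeneousProj_of_mem_ne B hy (by omega)
  exact h hx

theorem homogeneousProj_sub_mem {p : ℕ} {x : M} (hx : x ∈ ⨆ q ≥ p, B q) :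
    homogeneousProj B p x - x ∈ ⨆ q ≥ p + 1, B q := by
  have h : (⨆ q ≥ p, B q) ≤
      (⨆ q ≥ p + 1, B q).comap (homogeneousProj B p - LinearMap.id) := by
    refine iSup₂_le fun q hq y hy => ?_
    rw [Submodule.mem_comap, LinearMap.sub_apply, LinearMap.id_apply]
    rcases eq_or_ne q p with rfl | hne
    · rw [homogeneousProj_of_mem B hy, sub_self]
      exact zero_mem _
    · rw [homogeneousProj_of_mem_ne B hy hne, zero_sub]
      exact neg_mem (Submodule.mem_iSup_of_mem q
        (Submodule.mem_iSup_of_mem (show q ≥ p + 1 by omega) hy))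
  exact h hx

theorem homogeneousProj_eq_of_sub_mem {p : ℕ} {x b : M} (hb : b ∈ B p)
    (h : b - x ∈ ⨆ q ≥ p + 1, B q) : homogeneousProj B p x = b := by
  have h0 := homogeneousProj_of_mem_iSup B h
  rw [map_sub, homogeneousProj_of_mem B hb, sub_eq_zero] at h0
  exact h0.symm

theorem gradingComparison_of_mem {p : ℕ} {x : M} (hx : x ∈ B p) :
    gradingComparison B C x = homogeneousProj C p x := by
  simp only [gradingComparison, LinearMap.comp_apply, LinearEquiv.coe_coe,
    DirectSum.decomposeLinearEquiv_apply]
  rw [DirectSum.decompose_of_mem B hx]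
  erw [DirectSum.toModule_lof]
  rfl

variable {B C}

theorem gradingComparison_comp_self (hBC : ∀ r : ℕ, ⨆ p ≥ r, B p = ⨆ p ≥ r, C p) (x : M) :
    gradingComparison C B (gradingComparison B C x) = x := by
  induction x using DirectSum.Decomposition.inductionOn B with
  | zero => simp
  | @homogeneous p a =>
    rw [gradingComparison_of_mem B C a.2,
      gradingComparison_of_mem C B (homogeneousProj_mem C p _)]
    refine homogeneousProj_eq_of_sub_mem B a.2 ?_
    rw [← neg_sub, hBC]
    refine neg_mem (homogeneousProj_sub_mem C ?_)
    rw [← hBC]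
    exact Submodule.mem_iSup_of_mem p (Submodule.mem_iSup_of_mem le_rfl a.2)
  | add x y hx hy => rw [map_add, map_add, hx, hy]

theorem gradingComparison_sub_mem (hBC : ∀ r : ℕ, ⨆ p ≥ r, B p = ⨆ p ≥ r, C p) {r : ℕ} {x : M}
    (hx : x ∈ ⨆ p ≥ r, B p) : gradingComparison B C x - x ∈ ⨆ p ≥ r + 1, B p := by
  have h : (⨆ p ≥ r, B p) ≤
      (⨆ p ≥ r + 1, B p).comap (gradingComparison B C - LinearMap.id) := by
    refine iSup₂_le fun p hp y hy => ?_
    rw [Submodule.mem_comap, LinearMap.sub_apply, LinearMap.id_apply,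
      gradingComparison_of_mem B C hy]
    have hy' : y ∈ ⨆ q ≥ p, C q := by
      rw [← hBC]
      exact Submodule.mem_iSup_of_mem p (Submodule.mem_iSup_of_mem le_rfl hy)
    have h1 := homogeneousProj_sub_mem C hy'
    rw [← hBC] at h1
    have hle : (⨆ q ≥ p + 1, B q) ≤ ⨆ q ≥ r + 1, B q :=
      biSup_mono fun q hq => by omega
    exact hle h1
  exact h hx

/-- Two decompositions inducing the same filtration are related by a linear automorphism. -/
noncomputable def gradingComparisonEquiv (hBC : ∀ r : ℕ, ⨆ p ≥ r, B p = ⨆ p ≥ r, C p) :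
    M ≃ₗ[R] M :=
  LinearEquiv.ofLinearMap (gradingComparison B C) (gradingComparison C B)
    (LinearMap.ext (gradingComparison_comp_self fun r => (hBC r).symm))
    (LinearMap.ext (gradingComparison_comp_self hBC))

end Comparison

section Algebra

variable {R A : Type*} [CommRing R] [Ring A] [Algebra R A] {B C : ℕ → Submodule R A}

theorem mul_mem_iSup_ge (hC : ∀ p q : ℕ, ∀ a ∈ C p, ∀ b ∈ C q, a * b ∈ C (p + q))
    {r s : ℕ} {x y : A} (hx : x ∈ ⨆ p ≥ r, C p) (hy : y ∈ ⨆ p ≥ s, C p) :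
    x * y ∈ ⨆ p ≥ r + s, C p := by
  have h : (⨆ p ≥ r, C p) * (⨆ p ≥ s, C p) ≤ ⨆ p ≥ r + s, C p := by
    simp only [Submodule.iSup_mul, Submodule.mul_iSup]
    refine iSup₂_le fun q hq => iSup₂_le fun p hp => Submodule.mul_le.2 fun a ha b hb => ?_
    exact Submodule.mem_iSup_of_mem (p + q)
      (Submodule.mem_iSup_of_mem (show p + q ≥ r + s by omega) (hC p q a ha b hb))
  exact h (Submodule.mul_mem_mul hx hy)

variable [DirectSum.Decomposition B] [DirectSum.Decomposition C]

theorem gradingComparison_mul (hBC : ∀ r : ℕ, ⨆ p ≥ r, B p = ⨆ p ≥ r, C p)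
    (hB : ∀ p q : ℕ, ∀ a ∈ B p, ∀ b ∈ B q, a * b ∈ B (p + q))
    (hC : ∀ p q : ℕ, ∀ a ∈ C p, ∀ b ∈ C q, a * b ∈ C (p + q)) (x y : A) :
    gradingComparison B C (x * y) = gradingComparison B C x * gradingComparison B C y := by
  have hle : ∀ {p : ℕ} {a : A}, a ∈ B p → a ∈ ⨆ q ≥ p, C q := fun {p a} ha => by
    rw [← hBC]
    exact Submodule.mem_iSup_of_mem p (Submodule.mem_iSup_of_mem le_rfl ha)
  induction x using DirectSum.Decomposition.inductionOn B with
  | zero => simp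
  | add x x' hx hx' => rw [add_mul, map_add, map_add, add_mul, hx, hx']
  | @homogeneous p a =>
    induction y using DirectSum.Decomposition.inductionOn B with
    | zero => simp
    | add y y' hy hy' => rw [mul_add, map_add, map_add, mul_add, hy, hy']
    | @homogeneous q b =>
      obtain ⟨a, ha⟩ := a
      obtain ⟨b, hb⟩ := b
      rw [gradingComparison_of_mem B C ha, gradingComparison_of_mem B C hb,
        gradingComparison_of_mem B C (hB p q a ha b hb)]
      have hCa := homogeneousProj_mem C p a
      refine homogeneousProj_eq_of_sub_mem C (hC p q _ hCa _ (homogeneousProj_mem C q b)) ?_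
      have hsum : homogeneousProj C p a * homogeneousProj C q b - a * b =
          homogeneousProj C p a * (homogeneousProj C q b - b) +
            (homogeneousProj C p a - a) * b := by noncomm_ring
      rw [hsum]
      have h1 := mul_mem_iSup_ge hC
        (Submodule.mem_iSup_of_mem p (Submodule.mem_iSup_of_mem (le_refl p) hCa))
        (homogeneousProj_sub_mem C (hle hb))
      have h2 := mul_mem_iSup_ge hC (homogeneousProj_sub_mem C (hle ha)) (hle hb)
      rw [← add_assoc] at h1
      rw [add_right_comm] at h2
      exact add_mem h1 h2

end Algebra

/-- Koszul's uniqueness statement: any two ℕ-gradings of a ℂ-algebra `A` splitting the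
filtration by powers of a two-sided ideal `m` (with `m^(n+1) = 0`) are conjugate by an
algebra automorphism `φ` with `(φ - id)(m^r) ⊆ m^(r+1)` for every `r`; in particular
the corresponding grading derivations satisfy `W' = φ ∘ W ∘ φ⁻¹`. -/
theorem split_gradings_conjugate
    {A : Type*} [Ring A] [Algebra ℂ A] (m : Submodule ℂ A)
    (hleft : ∀ a : A, ∀ x ∈ m, a * x ∈ m) (hright : ∀ a : A, ∀ x ∈ m, x * a ∈ m)
    (n : ℕ) (hnil : mpow m (n + 1) = ⊥)
    (Ap Ap' : ℕ → Submodule ℂ A)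
    (hone : (1 : A) ∈ Ap 0)
    (hmul : ∀ p q : ℕ, ∀ a ∈ Ap p, ∀ b ∈ Ap q, a * b ∈ Ap (p + q))
    (hinternal : DirectSum.IsInternal Ap)
    (hsplit : ∀ r : ℕ, mpow m r = ⨆ p ≥ r, Ap p)
    (hone' : (1 : A) ∈ Ap' 0)
    (hmul' : ∀ p q : ℕ, ∀ a ∈ Ap' p, ∀ b ∈ Ap' q, a * b ∈ Ap' (p + q))
    (hinternal' : DirectSum.IsInternal Ap')
    (hsplit' : ∀ r : ℕ, mpow m r = ⨆ p ≥ r, Ap' p)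
    (W W' : A →ₗ[ℂ] A)
    (hW : ∀ p : ℕ, ∀ a ∈ Ap p, W a = (p : ℂ) • a)
    (hW' : ∀ p : ℕ, ∀ a ∈ Ap' p, W' a = (p : ℂ) • a) :
    ∃ φ : A ≃ₐ[ℂ] A,
      (∀ r : ℕ, ∀ x ∈ mpow m r, φ x - x ∈ mpow m (r + 1)) ∧
      (∀ p : ℕ, (Ap p).map (φ : A →ₗ[ℂ] A) = Ap' p) ∧
      (∀ a : A, W' a = φ (W (φ.symm a))) := by
  classical
  let _ := hinternal.chooseDecomposition
  let _ := hinternal'.chooseDecomposition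
  have hBC : ∀ r : ℕ, ⨆ p ≥ r, Ap p = ⨆ p ≥ r, Ap' p := fun r =>
    (hsplit r).symm.trans (hsplit' r)
  let φ : A ≃ₐ[ℂ] A := AlgEquiv.ofLinearEquiv (gradingComparisonEquiv hBC)
    ((gradingComparison_of_mem Ap Ap' hone).trans (homogeneousProj_of_mem Ap' hone'))
    (gradingComparison_mul hBC hmul hmul')
  have hφ : ∀ p : ℕ, ∀ a ∈ Ap p, φ a ∈ Ap' p := fun p a ha =>
    (gradingComparison_of_mem Ap Ap' ha).symm ▸ homogeneousProj_mem Ap' p a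
  have hφsymm : ∀ p : ℕ, ∀ a ∈ Ap' p, φ.symm a ∈ Ap p := fun p a ha =>
    (gradingComparison_of_mem Ap' Ap ha).symm ▸ homogeneousProj_mem Ap p a
  refine ⟨φ, fun r x hx => ?_, fun p => le_antisymm ?_ fun a ha => ?_, fun a => ?_⟩
  · rw [hsplit] at hx ⊢
    exact gradingComparison_sub_mem hBC hx
  · rintro _ ⟨a, ha, rfl⟩
    exact hφ p a ha
  · exact ⟨φ.symm a, hφsymm p a ha, φ.apply_symm_apply a⟩
  · induction a using DirectSum.Decomposition.inductionOn Ap' with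
    | zero => simp
    | add x y hx hy => simp only [map_add, hx, hy]
    | @homogeneous p a =>
      rw [hW' p a a.2, hW p _ (hφsymm p a a.2), map_smul, φ.apply_symm_apply]
end
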